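/- arXiv:math/0408028 — 3 statements merged into one kernel-verified Lean document; each statement's English description precedes it below -/
import Mathlib

section
/- Let n ≥ 4, let a, b > 0 and let 2 ≤ k < m ≤ n−1 be integers with a^m ≠ b^k. Let x₁, …, x_n and y₁, …, y_n be positive real numbers such that x_I + y_I = 2a for every I ⊆ {1, …, n} with |I| = k, and x_J + y_J = 2b for every J ⊆ {1, …, n} with |J| = m. Then there exists a constant c > 0 such that x_ι = c·y_ι for every ι ∈ {1, …, n}. -/
/-- Exchanging one index for another in a family of constant sums of products. -/
theorem sub_mul_prod_eq_of_prod_add_prod_eq {α : Type*} [DecidableEq α] {x y : α → ℝ} {q : ℕ}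
    {c : ℝ} (h : ∀ I : Finset α, I.card = q + 1 → ∏ ι ∈ I, x ι + ∏ ι ∈ I, y ι = c)
    {i j : α} {S : Finset α} (hi : i ∉ S) (hj : j ∉ S) (hS : S.card = q) :
    (x i - x j) * ∏ ι ∈ S, x ι = (y j - y i) * ∏ ι ∈ S, y ι := by
  have h₁ := h (insert i S) (by rw [Finset.card_insert_of_notMem hi, hS])
  have h₂ := h (insert j S) (by rw [Finset.card_insert_of_notMem hj, hS])
  rw [Finset.prod_insert hi, Finset.prod_insert hi] at h₁
  rw [Finset.prod_insert hj, Finset.prod_insert hj] at h₂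
  linarith

theorem Finset.exists_disjoint_card_eq {α : Type*} [Fintype α] [DecidableEq α] (A : Finset α)
    {q : ℕ} (h : A.card + q ≤ Fintype.card α) : ∃ S : Finset α, Disjoint A S ∧ S.card = q := by
  obtain ⟨S, hS, hc⟩ := Finset.exists_subset_card_eq (s := Aᶜ) (n := q)
    (by rw [Finset.card_compl]; omega)
  exact ⟨S, (Finset.subset_compl_iff_disjoint_left.mp hS), hc⟩

/-- If sums of products over `k`-subsets and over `m`-subsets are constant, then two indices with
`x i ≠ x j` force `x` and `y` to agree at all other indices. -/
theorem eq_of_ne_of_prod_add_prod_eq {α : Type*} [Fintype α] [DecidableEq α] {x y : α → ℝ}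
    {k m : ℕ} {c d : ℝ} (hkm : k < m) (hm : m + 3 ≤ Fintype.card α)
    (hx : ∀ ι, 0 < x ι) (hy : ∀ ι, 0 < y ι)
    (hI : ∀ I : Finset α, I.card = k + 2 → ∏ ι ∈ I, x ι + ∏ ι ∈ I, y ι = c)
    (hJ : ∀ J : Finset α, J.card = m + 2 → ∏ ι ∈ J, x ι + ∏ ι ∈ J, y ι = d)
    {i j : α} (hij : x i ≠ x j) {s : α} (hsi : s ≠ i) (hsj : s ≠ j) : x s = y s := by
  have hij' : x i - x j ≠ 0 := sub_ne_zero.mpr hij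
  have hprop : ∀ t, t ≠ i → t ≠ j → x t = x s / y s * y t := by
    intro t hti htj
    rcases eq_or_ne t s with rfl | hts
    · rw [div_mul_cancel₀ _ (hy t).ne']
    obtain ⟨T, hT, hTc⟩ := Finset.exists_disjoint_card_eq {i, j, s, t} (q := k)
      (by have := Finset.card_le_four (a := i) (b := j) (c := s) (d := t); omega)
    simp only [Finset.disjoint_insert_left, Finset.disjoint_singleton_left] at hT
    obtain ⟨hTi, hTj, hTs, hTt⟩ := hT
    have hs := sub_mul_prod_eq_of_prod_add_prod_eq hI (i := i) (j := j) (S := insert s T)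
      (by simp [hTi, hsi.symm]) (by simp [hTj, hsj.symm])
      (by rw [Finset.card_insert_of_notMem hTs, hTc])
    have ht := sub_mul_prod_eq_of_prod_add_prod_eq hI (i := i) (j := j) (S := insert t T)
      (by simp [hTi, hti.symm]) (by simp [hTj, htj.symm])
      (by rw [Finset.card_insert_of_notMem hTt, hTc])
    rw [Finset.prod_insert hTs, Finset.prod_insert hTs] at hs
    rw [Finset.prod_insert hTt, Finset.prod_insert hTt] at ht
    have hP : (x i - x j) * ∏ ι ∈ T, x ι ≠ 0 :=
      mul_ne_zero hij' (Finset.prod_pos fun ι _ => hx ι).ne'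
    rw [div_mul_eq_mul_div, eq_div_iff (hy s).ne']
    apply mul_left_cancel₀ hP
    linear_combination y s * ht - y t * hs
  have hpow : ∀ {q : ℕ} {e : ℝ}, q + 3 ≤ Fintype.card α →
      (∀ I : Finset α, I.card = q + 2 → ∏ ι ∈ I, x ι + ∏ ι ∈ I, y ι = e) →
      (x i - x j) * (x s / y s) ^ (q + 1) = y j - y i := by
    intro q e hq h
    obtain ⟨S, hS, hSc⟩ := Finset.exists_disjoint_card_eq {i, j} (q := q + 1)
      (by have := Finset.card_le_two (a := i) (b := j); omega)
    simp only [Finset.disjoint_insert_left, Finset.disjoint_singleton_left] at hS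
    have hS' := sub_mul_prod_eq_of_prod_add_prod_eq h hS.1 hS.2 hSc
    have hprod : ∏ ι ∈ S, x ι = (x s / y s) ^ (q + 1) * ∏ ι ∈ S, y ι := by
      rw [← hSc, ← Finset.prod_const, ← Finset.prod_mul_distrib]
      exact Finset.prod_congr rfl fun ι hι =>
        hprop ι (fun h => hS.1 (h ▸ hι)) (fun h => hS.2 (h ▸ hι))
    rw [hprod, ← mul_assoc] at hS'
    exact mul_right_cancel₀ (Finset.prod_pos fun ι _ => hy ι).ne' hS'
  have hk := hpow (by omega) hI
  have hm := hpow hm hJ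
  have hone : x s / y s = 1 := by
    by_contra hne
    have := pow_right_injective₀ (div_pos (hx s) (hy s)) hne
      (mul_left_cancel₀ hij' (hk.trans hm.symm))
    omega
  exact (div_eq_one_iff_eq (hy s).ne').mp hone

/-- Lemma on polynomial relations: if all `k`-fold products satisfy
`x_I + y_I = 2a` and all `m`-fold products satisfy `x_J + y_J = 2b`, with `a^m ≠ b^k`,
then the `x_ι` are proportional to the `y_ι`. -/
theorem stmt11 {n : ℕ} (hn : 4 ≤ n) (a b : ℝ) (ha : 0 < a) (hb : 0 < b)
    (k m : ℕ) (hk : 2 ≤ k) (hkm : k < m) (hm : m ≤ n - 1)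
    (hab : a ^ m ≠ b ^ k)
    (x y : Fin n → ℝ) (hx : ∀ ι, 0 < x ι) (hy : ∀ ι, 0 < y ι)
    (hI : ∀ I : Finset (Fin n), I.card = k → ∏ ι ∈ I, x ι + ∏ ι ∈ I, y ι = 2 * a)
    (hJ : ∀ J : Finset (Fin n), J.card = m → ∏ ι ∈ J, x ι + ∏ ι ∈ J, y ι = 2 * b) :
    ∃ c : ℝ, 0 < c ∧ ∀ ι, x ι = c * y ι := by
  by_cases hxy : ∀ ι, x ι = y ι
  · exact ⟨1, one_pos, by simpa using hxy⟩
  push Not at hxy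
  obtain ⟨p, hp⟩ := hxy
  obtain ⟨k, rfl⟩ := Nat.exists_eq_add_of_le' hk
  obtain ⟨m, rfl⟩ := Nat.exists_eq_add_of_le' (hk.trans hkm.le)
  have hne : ∀ {i j s : Fin n}, x i ≠ x j → s ≠ i → s ≠ j → x s = y s := fun hij hsi hsj =>
    eq_of_ne_of_prod_add_prod_eq (by omega) (by rw [Fintype.card_fin]; omega) hx hy hI hJ hij
      hsi hsj
  have hconst : ∀ s t, s ≠ p → t ≠ p → x s = x t := fun s t hs ht => by
    by_contra hst
    exact hp (hne hst hs.symm ht.symm)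
  by_cases hxp : ∀ s, x s = x p
  · refine ⟨x p / y p, div_pos (hx p) (hy p), fun ι => ?_⟩
    have hyp : y ι = y p := by
      obtain ⟨S, hS, hSc⟩ := Finset.exists_disjoint_card_eq {ι, p} (q := k + 1)
        (by have := Finset.card_le_two (a := ι) (b := p); rw [Fintype.card_fin]; omega)
      simp only [Finset.disjoint_insert_left, Finset.disjoint_singleton_left] at hS
      have h := sub_mul_prod_eq_of_prod_add_prod_eq hI hS.1 hS.2 hSc
      rw [hxp ι, sub_self, zero_mul] at h
      have hS_ne := (Finset.prod_pos fun ι (_ : ι ∈ S) => hy ι).ne'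
      linarith [(mul_eq_zero.mp h.symm).resolve_right hS_ne]
    rw [hxp ι, hyp, div_mul_cancel₀ _ (hy p).ne']
  · push Not at hxp
    obtain ⟨s, hs⟩ := hxp
    have hsp : s ≠ p := fun h => hs (h ▸ rfl)
    have hxs : ∀ t, t ≠ p → x t = x s := fun t ht => hconst t s ht hsp
    have hys : ∀ t, t ≠ p → y t = x s := by
      intro t ht
      obtain ⟨S, hS, hSc⟩ := Finset.exists_disjoint_card_eq {p, t} (q := 1)
        (by have := Finset.card_le_two (a := p) (b := t); rw [Fintype.card_fin]; omega)
      obtain ⟨r, rfl⟩ := Finset.card_eq_one.mp hSc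
      simp only [Finset.disjoint_singleton_right, Finset.mem_insert, Finset.mem_singleton,
        not_or] at hS
      rw [← hne (i := r) (j := p) (by rw [hxs r hS.1]; exact hs) (Ne.symm hS.2) ht, hxs t ht]
    have hpow : ∀ {q : ℕ} {e : ℝ}, q + 1 ≤ n →
        (∀ I : Finset (Fin n), I.card = q → ∏ ι ∈ I, x ι + ∏ ι ∈ I, y ι = 2 * e) →
        x s ^ q = e := by
      intro q e hq h
      obtain ⟨S, hS, hSc⟩ := Finset.exists_disjoint_card_eq {p} (q := q)
        (by rw [Finset.card_singleton, Fintype.card_fin]; omega)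
      rw [Finset.disjoint_singleton_left] at hS
      have hS' := h S hSc
      rw [Finset.prod_eq_pow_card fun t ht => hxs t (fun h => hS (h ▸ ht)),
        Finset.prod_eq_pow_card fun t ht => hys t (fun h => hS (h ▸ ht)), hSc] at hS'
      linarith
    refine absurd ?_ hab
    rw [← hpow (by omega) hI, ← hpow (by omega) hJ, ← pow_mul, ← pow_mul, mul_comm]
end

section
/- Let n ≥ 3, let a, b > 0 and let 1 ≤ k < m ≤ n−1 be integers with a^m ≠ b^k. Then there exists a finite set F ⊂ ℝ such that the following holds: whenever x₁, …, x_n are nonnegative and y₁, …, y_n are positive real numbers satisfying x_I + y_I = 2a for every I ⊆ {1, …, n} with |I| = k and x_J + y_J = 2b for every J ⊆ {1, …, n} with |J| = m, then y₁, …, y_n ∈ F. -/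
open Polynomial in
/-- The values of `y` for which the constant pair `(x, y)` solves the system. -/
theorem finite_setOf_pow_add_pow (a b : ℝ) (ha : 0 < a) {k m : ℕ} (hk : 1 ≤ k) (hkm : k < m) :
    {y : ℝ | ∃ x : ℝ, x ^ k + y ^ k = 2 * a ∧ x ^ m + y ^ m = 2 * b}.Finite := by
  set P : ℝ[X] := (C (2 * a) - X ^ k) ^ m - (C (2 * b) - X ^ m) ^ k with hP
  have hcomp : P = (expand ℝ k ((C (2 * a) - X) ^ m)) - (expand ℝ m ((C (2 * b) - X) ^ k)) := by
    simp [hP]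
  have h0 : P ≠ 0 := by
    intro h
    have h1 : P.coeff k = 0 := by simp [h]
    rw [hcomp, coeff_sub, coeff_expand (by omega), coeff_expand (by omega), if_pos dvd_rfl,
      if_neg (Nat.not_dvd_of_pos_of_lt (by omega) hkm), Nat.div_self (by omega), sub_zero] at h1
    have h2 : (derivative ((C (2 * a) - X) ^ m : ℝ[X])).coeff 0 = 0 := by
      rw [coeff_derivative, zero_add, h1, zero_mul]
    rw [coeff_zero_eq_eval_zero, derivative_pow] at h2
    simp at h2
    rcases h2 with h2 | h2
    · omega
    · exact ha.ne' h2.1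
  refine (P.roots.toFinset.finite_toSet).subset ?_
  rintro y ⟨x, h1, h2⟩
  rw [Finset.mem_coe, Multiset.mem_toFinset, mem_roots h0, IsRoot, hP]
  simp only [eval_sub, eval_pow, eval_C, eval_X]
  rw [← h1, ← h2, add_sub_cancel_right, add_sub_cancel_right, ← pow_mul, ← pow_mul, mul_comm,
    sub_self]

open Polynomial in
/-- The values of `y` in solutions with exactly two distinct coordinate pairs. -/
theorem finite_setOf_two_values (a d : ℝ) (hd : 0 < d) {u v : ℕ} (hu : 1 ≤ u) (hv : 1 ≤ v) :
    {y : ℝ | 0 < y ∧ y < 2 * a ∧ ∃ z : ℝ, 0 < z ∧ z < 2 * a ∧ y ^ u * z ^ v = d ∧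
      (2 * a - y) ^ u * (2 * a - z) ^ v = d}.Finite := by
  set P : ℝ[X] := C d * ((1 + X ^ v) ^ u * (1 + X ^ u) ^ v) - C ((2 * a) ^ (u + v)) * X ^ (u * v)
    with hP
  have h0 : P ≠ 0 := by
    intro h
    have h1 : P.eval 0 = 0 := by simp [h]
    have huv : u * v ≠ 0 := by positivity
    simp [hP, huv, show u ≠ 0 by omega, show v ≠ 0 by omega, hd.ne'] at h1
  refine ((P.roots.toFinset.image fun t => 2 * a / (1 + t ^ v)).finite_toSet).subset ?_
  rintro y ⟨hy, hya, z, hz, hza, h1, h2⟩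
  have hr : 0 < (2 * a - y) / y := div_pos (by linarith) hy
  have hs : 0 < (2 * a - z) / z := div_pos (by linarith) hz
  obtain ⟨t, ht, htv⟩ : ∃ t : ℝ, 0 < t ∧ t ^ v = (2 * a - y) / y :=
    ⟨_, Real.rpow_pos_of_pos hr _, Real.rpow_inv_natCast_pow hr.le (by omega)⟩
  have hst : ((2 * a - z) / z) * t ^ u = 1 := by
    refine (pow_eq_one_iff_of_nonneg (by positivity) (show v ≠ 0 by omega)).1 ?_
    rw [mul_pow, ← pow_mul, mul_comm u v, pow_mul, htv, div_pow, div_pow]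
    field_simp
    linarith
  have hy' : y * (1 + t ^ v) = 2 * a := by rw [htv]; field_simp; ring
  have hz' : z * (1 + t ^ u) = 2 * a * t ^ u := by
    field_simp at hst
    linarith
  simp only [Finset.coe_image, Set.mem_image, Finset.mem_coe, Multiset.mem_toFinset]
  refine ⟨t, ?_, by rw [← hy']; field_simp⟩
  rw [mem_roots h0, IsRoot, hP]
  simp only [eval_sub, eval_pow, eval_C, eval_X, eval_mul, eval_add, eval_one]
  have : (y * (1 + t ^ v)) ^ u * (z * (1 + t ^ u)) ^ v = (2 * a) ^ u * (2 * a * t ^ u) ^ v := by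
    rw [hy', hz']
  rw [mul_pow y, mul_pow z, mul_pow (2 * a) (t ^ u), ← pow_mul] at this
  rw [← h1, pow_add]
  linear_combination this

/-- If all subsets of `C` of a given intermediate size have the same nonzero product, then the
factors are constant on `C`. -/
theorem eq_of_forall_prod_eq {α : Type*} [DecidableEq α] {C : Finset α} {f : α → ℝ} {s : ℕ} {e : ℝ}
    (he : e ≠ 0) (hs : 1 ≤ s) (hsC : s < C.card)
    (h : ∀ S ⊆ C, S.card = s → ∏ i ∈ S, f i = e) {l l' : α} (hl : l ∈ C) (hl' : l' ∈ C) :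
    f l = f l' := by
  rcases eq_or_ne l l' with rfl | hne
  · rfl
  have hc : ((C.erase l).erase l').card = C.card - 2 := by
    rw [Finset.card_erase_of_mem (by simp [hl', hne.symm]), Finset.card_erase_of_mem hl]; omega
  obtain ⟨S, hS, hSc⟩ := Finset.exists_subset_card_eq (s := (C.erase l).erase l') (n := s - 1)
    (by omega)
  have hlS : l ∉ S := fun hh => by simpa using hS hh
  have hlS' : l' ∉ S := fun hh => by simpa using hS hh
  have hSC : S ⊆ C := hS.trans ((Finset.erase_subset _ _).trans (Finset.erase_subset _ _))
  have e1 := h (insert l S) (Finset.insert_subset hl hSC)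
    (by rw [Finset.card_insert_of_notMem hlS]; omega)
  have e2 := h (insert l' S) (Finset.insert_subset hl' hSC)
    (by rw [Finset.card_insert_of_notMem hlS']; omega)
  rw [Finset.prod_insert hlS] at e1
  rw [Finset.prod_insert hlS'] at e2
  exact mul_right_cancel₀ (right_ne_zero_of_mul (e1.trans_ne he)) (e1.trans e2.symm)

/-- In the case `k = 1`, `m = n - 1`, any two distinct values `y i`, `y j` satisfy a pair of
polynomial equations. -/
theorem exists_two_values {n : ℕ} (hn : 3 ≤ n) {a b : ℝ} (ha : 0 < a)
    (hab : a ^ (n - 1) ≠ b) {x y : Fin n → ℝ} (hx : ∀ i, 0 ≤ x i) (hy : ∀ i, 0 < y i)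
    (hI : ∀ i, x i + y i = 2 * a)
    (hJ : ∀ J : Finset (Fin n), J.card = n - 1 → ∏ i ∈ J, x i + ∏ i ∈ J, y i = 2 * b)
    {i j : Fin n} (hij : y i ≠ y j) :
    ∃ u < n, ∃ v < n, 1 ≤ u ∧ 1 ≤ v ∧ y i < 2 * a ∧ y j < 2 * a ∧
      y i ^ u * y j ^ v = b / a ∧ (2 * a - y i) ^ u * (2 * a - y j) ^ v = b / a := by
  have hcard : ∀ i j : Fin n, i ≠ j → ((Finset.univ.erase i).erase j).card = n - 2 := by
    intro i j h
    rw [Finset.card_erase_of_mem (by simp [h.symm]), Finset.card_erase_of_mem (by simp)]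
    simp; omega
  have hswap : ∀ i j : Fin n, y i ≠ y j →
      ∏ l ∈ (Finset.univ.erase i).erase j, x l = ∏ l ∈ (Finset.univ.erase i).erase j, y l ∧
      a * ∏ l ∈ (Finset.univ.erase i).erase j, y l = b := by
    intro i j h
    have hne : i ≠ j := fun hh => h (by rw [hh])
    have hc := hcard i j hne
    set D := (Finset.univ.erase i).erase j with hD
    have hi : i ∉ D := by simp [hD]
    have hj : j ∉ D := by simp [hD]
    have e1 := hJ (insert i D) (by rw [Finset.card_insert_of_notMem hi]; omega)
    have e2 := hJ (insert j D) (by rw [Finset.card_insert_of_notMem hj]; omega)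
    rw [Finset.prod_insert hi, Finset.prod_insert hi] at e1
    rw [Finset.prod_insert hj, Finset.prod_insert hj] at e2
    have hxy : ∏ l ∈ D, x l = ∏ l ∈ D, y l := by
      refine mul_left_cancel₀ (sub_ne_zero.2 h) ?_
      linear_combination e2 - e1 + (∏ l ∈ D, x l) * (hI i - hI j)
    refine ⟨hxy, ?_⟩
    rw [hxy] at e1
    linear_combination e1 / 2 - (∏ l ∈ D, y l) / 2 * hI i
  have hne : i ≠ j := fun hh => hij (by rw [hh])
  obtain ⟨h1, h2⟩ := hswap i j hij
  have hc := hcard i j hne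
  have hval : ∀ l ∈ (Finset.univ.erase i).erase j, y l ≠ y i → y l = y j := by
    intro l hl hli
    have hlj : l ≠ j := by rintro rfl; simp at hl
    have hlii : l ≠ i := by rintro rfl; simp at hl
    obtain ⟨h3, -⟩ := hswap i l (Ne.symm hli)
    have hjl : j ∈ (Finset.univ.erase i).erase l := by simp [hlj.symm, hne.symm]
    rw [← Finset.mul_prod_erase _ _ hl, ← Finset.mul_prod_erase _ _ hl] at h1
    rw [← Finset.mul_prod_erase _ _ hjl, ← Finset.mul_prod_erase _ _ hjl,
      Finset.erase_right_comm] at h3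
    set X := ∏ p ∈ ((Finset.univ.erase i).erase j).erase l, x p with hX
    set Y := ∏ p ∈ ((Finset.univ.erase i).erase j).erase l, y p with hY
    have hYpos : 0 < Y := Finset.prod_pos fun p _ => hy p
    have hXne : X ≠ 0 := by
      have : x l * X ≠ 0 := by rw [h1]; exact (mul_pos (hy l) hYpos).ne'
      exact right_ne_zero_of_mul this
    have h4 : X + Y ≠ 0 := by
      have : 0 ≤ X := Finset.prod_nonneg fun p _ => hx p
      positivity
    refine mul_right_cancel₀ h4 ?_
    linear_combination h3 - h1 + X * (hI l - hI j)
  set D := (Finset.univ.erase i).erase j with hD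
  have hprod : ∀ f : ℝ → ℝ, ∏ l ∈ D, f (y l) =
      f (y i) ^ (D.filter (fun l => y l = y i)).card *
        f (y j) ^ (D.filter (fun l => ¬ y l = y i)).card := by
    intro f
    rw [← Finset.prod_filter_mul_prod_filter_not D (fun l => y l = y i)]
    congr 1
    · refine Finset.prod_eq_pow_card fun l hl => ?_
      rw [(Finset.mem_filter.1 hl).2]
    · refine Finset.prod_eq_pow_card fun l hl => ?_
      rw [hval l (Finset.mem_filter.1 hl).1 (Finset.mem_filter.1 hl).2]
  have huv := Finset.card_filter_add_card_filter_not (s := D) (fun l => y l = y i)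
  have hyp := hprod id
  have hxp := hprod (fun t => 2 * a - t)
  have hxe : ∏ l ∈ D, (2 * a - y l) = ∏ l ∈ D, x l :=
    Finset.prod_congr rfl fun l _ => by linarith [hI l]
  rw [hxe] at hxp
  set u := (D.filter (fun l => y l = y i)).card
  set v := (D.filter (fun l => ¬ y l = y i)).card
  simp only [id] at hyp
  have hkey : ∀ l, x l ^ (n - 2) = y l ^ (n - 2) → a * y l ^ (n - 2) = b → False := by
    intro l h3 h4
    have h5 : x l = y l := (pow_left_inj₀ (hx l) (hy l).le (by omega)).1 h3
    have h6 : y l = a := by linarith [hI l]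
    apply hab
    rw [← h4, h6, ← pow_succ']
    congr 1; omega
  have hxi : ∀ l, 2 * a - y l = x l := fun l => by linarith [hI l]
  have hu : 1 ≤ u := by
    by_contra hcon
    have hu0 : u = 0 := by omega
    have hv0 : v = n - 2 := by omega
    rw [hu0, hv0, pow_zero, one_mul] at hyp hxp
    rw [hxi] at hxp
    exact hkey j (by rw [← hxp, ← hyp, h1]) (by rw [← hyp, h2])
  have hv : 1 ≤ v := by
    by_contra hcon
    have hv0 : v = 0 := by omega
    have hu0 : u = n - 2 := by omega
    rw [hu0, hv0, pow_zero, mul_one] at hyp hxp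
    rw [hxi] at hxp
    exact hkey i (by rw [← hxp, ← hyp, h1]) (by rw [← hyp, h2])
  have hYpos : 0 < ∏ l ∈ D, y l := Finset.prod_pos fun p _ => hy p
  have hd : ∏ l ∈ D, y l = b / a := by rw [← h2]; field_simp
  have hne0 : (2 * a - y i) ^ u * (2 * a - y j) ^ v ≠ 0 := by
    rw [← hxp, h1]; exact hYpos.ne'
  have hlt : ∀ l, 2 * a - y l ≠ 0 → y l < 2 * a := fun l hl => by
    rw [hxi] at hl
    linarith [lt_of_le_of_ne (hx l) hl.symm, hI l]
  refine ⟨u, by omega, v, by omega, hu, hv, hlt i ?_, hlt j ?_, by rw [← hyp, hd],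
    by rw [← hxp, h1, hd]⟩
  · exact fun hh => hne0 (by rw [hh, zero_pow (by omega), zero_mul])
  · exact fun hh => hne0 (by rw [hh, zero_pow (by omega), mul_zero])

/-- If `y i = y j` but `x i ≠ x j`, then all products of `m` of the `x`'s vanish and `y` is
constant. -/
theorem pow_eq_of_eq_of_ne {n : ℕ} {a b : ℝ} (hb : 0 < b) {k m : ℕ}
    (hk : 1 ≤ k) (hkm : k < m) (hm : m ≤ n - 1) {x y : Fin n → ℝ}
    (hI : ∀ I : Finset (Fin n), I.card = k → ∏ ι ∈ I, x ι + ∏ ι ∈ I, y ι = 2 * a)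
    (hJ : ∀ J : Finset (Fin n), J.card = m → ∏ ι ∈ J, x ι + ∏ ι ∈ J, y ι = 2 * b)
    {i j : Fin n} (hyij : y i = y j) (hxij : x i ≠ x j) : y i ^ m = 2 * b := by
  have hx0 : ∀ J : Finset (Fin n), J.card = m → ∏ ι ∈ J, x ι = 0 := by
    intro J hJc
    have hc1 := Finset.pred_card_le_card_erase (s := J) (a := i)
    have hc2 := Finset.pred_card_le_card_erase (s := J.erase i) (a := j)
    obtain ⟨K, hK, hKc⟩ := Finset.exists_subset_card_eq (s := (J.erase i).erase j) (n := k - 1)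
      (by omega)
    have hiK : i ∉ K := fun hh => by simpa using hK hh
    have hjK : j ∉ K := fun hh => by simpa using hK hh
    have e1 := hI (insert i K) (by rw [Finset.card_insert_of_notMem hiK]; omega)
    have e2 := hI (insert j K) (by rw [Finset.card_insert_of_notMem hjK]; omega)
    rw [Finset.prod_insert hiK, Finset.prod_insert hiK] at e1
    rw [Finset.prod_insert hjK, Finset.prod_insert hjK, ← hyij] at e2
    have h0 : ∏ ι ∈ K, x ι = 0 := by
      refine (mul_eq_zero.1 ?_).resolve_left (sub_ne_zero.2 hxij)
      linear_combination e1 - e2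
    have hKJ : K ⊆ J := hK.trans ((Finset.erase_subset _ _).trans (Finset.erase_subset _ _))
    exact zero_dvd_iff.1 (h0 ▸ Finset.prod_dvd_prod_of_subset K J x hKJ)
  have hyJ : ∀ J : Finset (Fin n), J.card = m → ∏ ι ∈ J, y ι = 2 * b := fun J hJc => by
    rw [← hJ J hJc, hx0 J hJc, zero_add]
  have hconst : ∀ l, y l = y i := fun l =>
    eq_of_forall_prod_eq (C := Finset.univ) (s := m) (e := 2 * b) (by positivity) (by omega)
      (by simp; omega) (fun S _ => hyJ S) (Finset.mem_univ _) (Finset.mem_univ _)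
  obtain ⟨J, -, hJc⟩ := Finset.exists_subset_card_eq (s := (Finset.univ : Finset (Fin n))) (n := m)
    (by simp; omega)
  rw [← hyJ J hJc, Finset.prod_congr rfl fun l _ => hconst l, Finset.prod_const, hJc]

/-- Outside the case `k = 1`, `m = n - 1`, a solution with `y i ≠ y j` forces `a ^ m = b ^ k`. -/
theorem pow_eq_pow_of_ne {n : ℕ} {a b : ℝ} {k m : ℕ}
    (hk : 1 ≤ k) (hkm : k < m) (hm : m ≤ n - 1) (hkmn : 2 ≤ k ∨ m < n - 1) {x y : Fin n → ℝ}
    (hx : ∀ ι, 0 ≤ x ι) (hy : ∀ ι, 0 < y ι)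
    (hI : ∀ I : Finset (Fin n), I.card = k → ∏ ι ∈ I, x ι + ∏ ι ∈ I, y ι = 2 * a)
    (hJ : ∀ J : Finset (Fin n), J.card = m → ∏ ι ∈ J, x ι + ∏ ι ∈ J, y ι = 2 * b)
    {i j : Fin n} (hij : y i ≠ y j) : a ^ m = b ^ k := by
  have hne : i ≠ j := fun hh => hij (by rw [hh])
  have hc : ((Finset.univ.erase i).erase j).card = n - 2 := by
    rw [Finset.card_erase_of_mem (by simp [hne.symm]), Finset.card_erase_of_mem (by simp)]
    simp; omega
  set D := (Finset.univ.erase i).erase j with hD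
  have hins : ∀ (s : ℕ) (c : ℝ), 1 ≤ s → (∀ I : Finset (Fin n), I.card = s →
      ∏ ι ∈ I, x ι + ∏ ι ∈ I, y ι = 2 * c) → ∀ K ⊆ D, K.card = s - 1 →
      x i * ∏ ι ∈ K, x ι + y i * ∏ ι ∈ K, y ι = 2 * c ∧
      x j * ∏ ι ∈ K, x ι + y j * ∏ ι ∈ K, y ι = 2 * c := by
    intro s c hs h K hK hKc
    have hiK : i ∉ K := fun hh => by simpa [hD] using hK hh
    have hjK : j ∉ K := fun hh => by simpa [hD] using hK hh
    have e1 := h (insert i K) (by rw [Finset.card_insert_of_notMem hiK]; omega)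
    have e2 := h (insert j K) (by rw [Finset.card_insert_of_notMem hjK]; omega)
    rw [Finset.prod_insert hiK, Finset.prod_insert hiK] at e1
    rw [Finset.prod_insert hjK, Finset.prod_insert hjK] at e2
    exact ⟨e1, e2⟩
  have hinsk := hins k a hk hI
  have hinsm := hins m b (by omega) hJ
  have hypos : ∀ K : Finset (Fin n), 0 < ∏ ι ∈ K, y ι := fun K => Finset.prod_pos fun p _ => hy p
  obtain ⟨K, hKD, hKc⟩ := Finset.exists_subset_card_eq (s := D) (n := k - 1) (by omega)
  obtain ⟨M, hMD, hMc⟩ := Finset.exists_subset_card_eq (s := D) (n := m - 1) (by omega)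
  obtain ⟨I, hID, hIc⟩ := Finset.exists_subset_card_eq (s := D) (n := k) (by omega)
  have hxij : x i - x j ≠ 0 := by
    intro h0
    obtain ⟨e1, e2⟩ := hinsk K hKD hKc
    refine mul_ne_zero (sub_ne_zero.2 hij) (hypos K).ne' ?_
    linear_combination e1 - e2 - h0 * ∏ ι ∈ K, x ι
  set e := (y j - y i) / (x i - x j) with he
  have he0 : e ≠ 0 := div_ne_zero (sub_ne_zero.2 hij.symm) hxij
  set r : Fin n → ℝ := fun l => x l / y l with hr
  have hrprod : ∀ (s : ℕ) (c : ℝ), 1 ≤ s → (∀ I : Finset (Fin n), I.card = s →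
      ∏ ι ∈ I, x ι + ∏ ι ∈ I, y ι = 2 * c) → ∀ K ⊆ D, K.card = s - 1 → ∏ ι ∈ K, r ι = e := by
    intro s c hs h K hK hKc
    obtain ⟨e1, e2⟩ := hins s c hs h K hK hKc
    rw [hr, Finset.prod_div_distrib, he, div_eq_div_iff (hypos K).ne' hxij]
    linear_combination e1 - e2
  have hrk := hrprod k a hk hI
  have hrm := hrprod m b (by omega) hJ
  obtain ⟨l₀, hl₀⟩ : D.Nonempty := Finset.card_pos.1 (by omega)
  have hrc : ∀ l ∈ D, r l = r l₀ := by
    intro l hl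
    rcases hkmn with h | h
    · exact eq_of_forall_prod_eq he0 (by omega) (by omega) hrk hl hl₀
    · exact eq_of_forall_prod_eq he0 (by omega) (by omega) hrm hl hl₀
  have hconst : ∀ (f : Fin n → ℝ), (∀ l ∈ D, f l = f l₀) → ∀ S ⊆ D, ∏ ι ∈ S, f ι = f l₀ ^ S.card :=
    fun f hf S hS => Finset.prod_eq_pow_card fun l hl => hf l (hS hl)
  have hrK := hconst r hrc K hKD
  have hrM := hconst r hrc M hMD
  rw [hrk K hKD hKc, hKc] at hrK
  rw [hrm M hMD hMc, hMc] at hrM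
  have hr1 : r l₀ = 1 := by
    refine (pow_eq_one_iff_of_nonneg (div_nonneg (hx _) (hy _).le) (show m - k ≠ 0 by omega)).1 ?_
    refine mul_left_cancel₀ he0 ?_
    nth_rewrite 1 [hrK]
    rw [← pow_add, mul_one, show k - 1 + (m - k) = m - 1 by omega, hrM]
  have he1 : e = 1 := by rw [hrK, hr1, one_pow]
  have hxy : ∀ l ∈ D, x l = y l := fun l hl => by
    have := (hrc l hl).trans hr1
    rwa [hr, div_eq_one_iff_eq (hy l).ne'] at this
  have hxyp : ∀ S ⊆ D, ∏ ι ∈ S, x ι = ∏ ι ∈ S, y ι := fun S hS =>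
    Finset.prod_congr rfl fun l hl => hxy l (hS hl)
  set s := (x i + y i) / 2 with hs
  have hspos : 0 < s := by have := hx i; have := hy i; positivity
  have hyk : ∀ S ⊆ D, S.card = k - 1 → ∏ ι ∈ S, y ι = a / s := by
    intro S hS hSc
    obtain ⟨e1, -⟩ := hinsk S hS hSc
    rw [hxyp S hS] at e1
    rw [eq_div_iff hspos.ne', hs]
    linear_combination e1 / 2
  have hym : ∀ S ⊆ D, S.card = m - 1 → ∏ ι ∈ S, y ι = b / s := by
    intro S hS hSc
    obtain ⟨e1, -⟩ := hinsm S hS hSc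
    rw [hxyp S hS] at e1
    rw [eq_div_iff hspos.ne', hs]
    linear_combination e1 / 2
  have hyc : ∀ l ∈ D, y l = y l₀ := by
    intro l hl
    rcases hkmn with h | h
    · exact eq_of_forall_prod_eq (hyk K hKD hKc ▸ (hypos K).ne') (by omega) (by omega) hyk hl hl₀
    · exact eq_of_forall_prod_eq (hym M hMD hMc ▸ (hypos M).ne') (by omega) (by omega) hym hl hl₀
  have hyI := hI I hIc
  rw [hxyp I hID, hconst y hyc I hID, hIc] at hyI
  have hyK := hyk K hKD hKc
  have hyM := hym M hMD hMc
  rw [hconst y hyc K hKD, hKc, eq_div_iff hspos.ne'] at hyK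
  rw [hconst y hyc M hMD, hMc, eq_div_iff hspos.ne'] at hyM
  have hya : y l₀ ^ k = a := by linarith
  have hys : y l₀ = s := by
    refine mul_left_cancel₀ (pow_pos (hy l₀) (k - 1)).ne' ?_
    rw [hyK, ← pow_succ, Nat.sub_add_cancel hk, hya]
  rw [← hys, ← pow_succ, Nat.sub_add_cancel (by omega)] at hyM
  rw [← hya, ← hyM, ← pow_mul, ← pow_mul, mul_comm]

/-- Lemma on finiteness of solutions: there is a finite set `F`, depending
only on `a, b, k, m` (and `n`), containing all possible values `y₁, …, y_n`. -/
theorem stmt12 {n : ℕ} (hn : 3 ≤ n) (a b : ℝ) (ha : 0 < a) (hb : 0 < b)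
    (k m : ℕ) (hk : 1 ≤ k) (hkm : k < m) (hm : m ≤ n - 1)
    (hab : a ^ m ≠ b ^ k) :
    ∃ F : Finset ℝ, ∀ x y : Fin n → ℝ,
      (∀ ι, 0 ≤ x ι) → (∀ ι, 0 < y ι) →
      (∀ I : Finset (Fin n), I.card = k → ∏ ι ∈ I, x ι + ∏ ι ∈ I, y ι = 2 * a) →
      (∀ J : Finset (Fin n), J.card = m → ∏ ι ∈ J, x ι + ∏ ι ∈ J, y ι = 2 * b) →
      ∀ ι, y ι ∈ F := by
  have hfin2 : {y : ℝ | 0 < y ∧ y ^ m = 2 * b}.Finite :=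
    Set.Subsingleton.finite fun y hy z hz =>
      (pow_left_inj₀ hy.1.le hz.1.le (by omega)).1 (hy.2.trans hz.2.symm)
  have hfin3 : (⋃ u ∈ Finset.Ico 1 n, ⋃ v ∈ Finset.Ico 1 n,
      {y : ℝ | 0 < y ∧ y < 2 * a ∧ ∃ z : ℝ, 0 < z ∧ z < 2 * a ∧ y ^ u * z ^ v = b / a ∧
        (2 * a - y) ^ u * (2 * a - z) ^ v = b / a}).Finite :=
    (Finset.Ico 1 n).finite_toSet.biUnion fun u hu => (Finset.Ico 1 n).finite_toSet.biUnion
      fun v hv => finite_setOf_two_values a (b / a) (div_pos hb ha)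
        (Finset.mem_Ico.1 hu).1 (Finset.mem_Ico.1 hv).1
  have hfin := ((finite_setOf_pow_add_pow a b ha hk hkm).union hfin2).union hfin3
  refine ⟨hfin.toFinset, fun x y hx hy hI hJ i => ?_⟩
  rw [Set.Finite.mem_toFinset]
  by_cases hy' : ∀ j, y i = y j
  · left
    by_cases hx' : ∀ j, x i = x j
    · left
      have hpow : ∀ s ≤ n, ∃ S : Finset (Fin n), S.card = s ∧
          ∏ ι ∈ S, x ι = x i ^ s ∧ ∏ ι ∈ S, y ι = y i ^ s := by
        intro s hs
        obtain ⟨S, -, rfl⟩ := Finset.exists_subset_card_eq (s := (Finset.univ : Finset (Fin n)))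
          (n := s) (by simpa using hs)
        exact ⟨S, rfl, Finset.prod_eq_pow_card fun l _ => (hx' l).symm,
          Finset.prod_eq_pow_card fun l _ => (hy' l).symm⟩
      obtain ⟨I, hIc, h1, h2⟩ := hpow k (by omega)
      obtain ⟨J, hJc, h3, h4⟩ := hpow m (by omega)
      exact ⟨x i, by rw [← h1, ← h2, hI I hIc], by rw [← h3, ← h4, hJ J hJc]⟩
    · right
      push Not at hx'
      obtain ⟨j, hj⟩ := hx'
      exact ⟨hy i, pow_eq_of_eq_of_ne hb hk hkm hm hI hJ (hy' j) hj⟩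
  · push Not at hy'
    obtain ⟨j, hj⟩ := hy'
    by_cases hkmn : 2 ≤ k ∨ m < n - 1
    · exact absurd (pow_eq_pow_of_ne hk hkm hm hkmn hx hy hI hJ hj) hab
    · right
      obtain rfl : k = 1 := by omega
      obtain rfl : m = n - 1 := by omega
      obtain ⟨u, hun, v, hvn, hu, hv, h1, h2, h3, h4⟩ := exists_two_values hn ha
        (by simpa using hab) hx hy (fun l => by simpa using hI {l} (by simp)) hJ hj
      simp only [Set.mem_iUnion]
      exact ⟨u, Finset.mem_Ico.2 ⟨hu, hun⟩, v, Finset.mem_Ico.2 ⟨hv, hvn⟩, hy i, h1, y j, hy j, h2,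
        h3, h4⟩
end

section
/- Let n ≥ 5, k ∈ {2, …, n−3}, and γ > 0. Let 0 < x₁ ≤ x₂ ≤ … ≤ x_{n−1} be positive real numbers such that for every subset I ⊆ {1, …, n−1} with |I| = k, x_I + x_{I*} = 2γ, where I* := {n−i : i ∈ I}. Then x₁ = x₂ = … = x_{n−1}. -/
/-- The algebraic core: if six weighted sums of products of pairs from `a, b, c, d` agree,
then `a = d`. -/
theorem eq_of_weighted_pair_sums_eq {a b c d P Q γ : ℝ} (ha : 0 < a) (hb : 0 < b) (hd : 0 < d)
    (hP : 0 < P) (hQ : 0 < Q)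
    (hab : a * b * P + d * c * Q = 2 * γ) (hac : a * c * P + d * b * Q = 2 * γ)
    (hdb : d * b * P + a * c * Q = 2 * γ) (hdc : d * c * P + a * b * Q = 2 * γ)
    (had : a * d * P + d * a * Q = 2 * γ) (hbc : b * c * P + c * b * Q = 2 * γ) :
    a = d := by
  by_contra hne
  have hbc_eq : b = c := by
    by_contra hbc_ne
    have hbc0 : b - c ≠ 0 := sub_ne_zero.mpr hbc_ne
    have h₁ : a * P = d * Q := mul_left_cancel₀ hbc0 (by linear_combination hab - hac)
    have h₂ : d * P = a * Q := mul_left_cancel₀ hbc0 (by linear_combination hdb - hdc)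
    have hsq : a ^ 2 = d ^ 2 := mul_left_cancel₀ (mul_pos hP hQ).ne' (by
      linear_combination a * Q * h₁ - d * Q * h₂)
    exact hne ((sq_eq_sq₀ ha.le hd.le).mp hsq)
  subst hbc_eq
  have hPQ : P = Q := mul_left_cancel₀ (mul_ne_zero (sub_ne_zero.mpr hne) hb.ne') (by
    linear_combination hab - hdb)
  subst hPQ
  have hmul : a * d = b ^ 2 := mul_left_cancel₀ hP.ne' (by linear_combination (had - hbc) / 2)
  have hadd : a + d = 2 * b := mul_left_cancel₀ (mul_pos hP hb).ne' (by
    linear_combination hab - hbc)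
  have hzero : (a - d) ^ 2 = 0 := by
    linear_combination (a + d + 2 * b) * hadd - 4 * hmul
  exact hne (sub_eq_zero.mp (pow_eq_zero_iff two_ne_zero |>.mp hzero))


/-- Lemma 5.1: here `x : Fin (n-1) → ℝ` encodes `x₁, …, x_{n−1}` (index
`i : Fin (n-1)` corresponds to the subscript `i+1`), and the reflection `I* = {n−i : i ∈ I}`
corresponds to taking the image of `I` under `Fin.rev` (which sends index `i` to `n−2−i`,
i.e. subscript `i+1` to `n−(i+1)`). -/
theorem stmt13 {n : ℕ} (hn : 5 ≤ n) (k : ℕ) (hk2 : 2 ≤ k) (hkn : k ≤ n - 3)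
    (γ : ℝ) (hγ : 0 < γ) (x : Fin (n - 1) → ℝ)
    (hxpos : ∀ i, 0 < x i) (hxmono : Monotone x)
    (hI : ∀ I : Finset (Fin (n - 1)), I.card = k →
      ∏ i ∈ I, x i + ∏ i ∈ I.image Fin.rev, x i = 2 * γ) :
    ∀ i j, x i = x j := by
  obtain ⟨m, rfl⟩ : ∃ m, n = m + 5 := ⟨n - 5, by omega⟩
  change Fin (m + 4) → ℝ at x
  replace hI : ∀ I : Finset (Fin (m + 4)), I.card = k →
      ∏ i ∈ I, x i + ∏ i ∈ I.image Fin.rev, x i = 2 * γ := hI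
  let p : Fin (m + 4) := ⟨0, by omega⟩
  let q : Fin (m + 4) := ⟨1, by omega⟩
  have hp_rev : p.rev.val = m + 3 := by simp [p]
  have hq_rev : q.rev.val = m + 2 := by simp [q, Fin.val_rev]
  have hpq : p ≠ q := by simp [p, q]
  have hpq' : p ≠ q.rev := by rw [Ne, Fin.ext_iff, hq_rev]; simp [p]
  have hpp' : p ≠ p.rev := by rw [Ne, Fin.ext_iff, hp_rev]; simp [p]
  have hqq' : q ≠ q.rev := by rw [Ne, Fin.ext_iff, hq_rev]; simp [q]
  have hp'q : p.rev ≠ q := by rw [Ne, Fin.ext_iff, hp_rev]; simp [q]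
  have hp'q' : p.rev ≠ q.rev := by simpa using hpq
  let E : Finset (Fin (m + 4)) := {p, q, q.rev, p.rev}
  obtain ⟨K, hKE, hK⟩ : ∃ K ⊆ Eᶜ, K.card = k - 2 := by
    apply Finset.exists_subset_card_eq
    have hE : E.card ≤ 4 := Finset.card_le_four
    rw [Finset.card_compl, Fintype.card_fin]
    omega
  have hnotMem : ∀ i ∈ E, i ∉ K := fun i hi hiK => Finset.mem_compl.mp (hKE hiK) hi
  have hpair : ∀ i ∈ E, ∀ j ∈ E, i ≠ j →
      x i * x j * ∏ l ∈ K, x l + x i.rev * x j.rev * ∏ l ∈ K, x l.rev = 2 * γ := by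
    intro i hi j hj hij
    have hiK : i ∉ insert j K := by simp [hij, hnotMem i hi]
    have h := hI (insert i (insert j K)) (by
      rw [Finset.card_insert_of_notMem hiK, Finset.card_insert_of_notMem (hnotMem j hj), hK]
      omega)
    rw [Finset.prod_image Fin.rev_injective.injOn] at h
    simp only [Finset.prod_insert hiK, Finset.prod_insert (hnotMem j hj), ← mul_assoc] at h
    exact h
  have hends : x p = x p.rev := by
    apply eq_of_weighted_pair_sums_eq (b := x q) (c := x q.rev) (hxpos _) (hxpos _) (hxpos _)
      (Finset.prod_pos fun l (_ : l ∈ K) => hxpos l)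
      (Finset.prod_pos fun l (_ : l ∈ K) => hxpos l.rev)
    · exact hpair p (by simp [E]) q (by simp [E]) hpq
    · simpa using hpair p (by simp [E]) q.rev (by simp [E]) hpq'
    · simpa using hpair p.rev (by simp [E]) q (by simp [E]) hp'q
    · simpa using hpair p.rev (by simp [E]) q.rev (by simp [E]) hp'q'
    · simpa using hpair p (by simp [E]) p.rev (by simp [E]) hpp'
    · simpa using hpair q (by simp [E]) q.rev (by simp [E]) hqq'
  have hconst : ∀ i, x i = x p := fun i =>
    le_antisymm
      ((hxmono (Fin.le_def.mpr (by rw [hp_rev]; have := i.isLt; omega))).trans_eq hends.symm)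
      (hxmono (Fin.le_def.mpr (Nat.zero_le _)))
  exact fun i j => (hconst i).trans (hconst j).symm
end
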